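/- arXiv:1503.02857 — 4 statements merged into one kernel-verified Lean document; each statement's English description precedes it below -/
import Mathlib

section
/- Let D ∈ ℝ^{d×d} be any matrix. With Ĵ = D J, Ĥ_i = Σ_{k=1}^d D_{i,k} H_k, R̂ = D R Dᵀ, Ξ̂_{i,j} = tr(P Ĥ_i P Ĥ_j), and Ŝ = Ĵ P Ĵᵀ + (1/2) Ξ̂ + R̂, one has Ŝ = D S Dᵀ, where S = J P Jᵀ + (1/2) Ξ + R and Ξ_{i,j} = tr(P H_i P H_j). -/
open Matrix

/-- The Gram-type matrix `tr (P Hᵢ P Hⱼ)` transforms by congruence when the family `H` is replaced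
by linear combinations of its members. -/
theorem trace_mul_linearCombination_eq_congr {R ι κ ν : Type*} [CommSemiring R] [Fintype κ]
    [Fintype ν] (P : Matrix ν ν R) (H : κ → Matrix ν ν R) (D : Matrix ι κ R) (i j : ι) :
    (P * (∑ k, D i k • H k) * P * ∑ l, D j l • H l).trace =
      (D * Matrix.of (fun k l => (P * H k * P * H l).trace) * Dᵀ) i j := by
  simp only [mul_apply, transpose_apply, of_apply, Matrix.mul_sum,
    Matrix.mul_smul, Matrix.smul_mul, trace_sum, trace_smul, smul_eq_mul, Finset.sum_mul]
  rw [Finset.sum_comm]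
  refine Finset.sum_congr rfl fun l _ => Finset.sum_congr rfl fun k _ => ?_
  ring

/-- The EKF2 innovation covariance transforms by congruence under a linear transformation of
the measurement model: `Ŝ = D S Dᵀ`. -/
theorem ekf2_innovation_covariance_transform {n d : ℕ}
    (P : Matrix (Fin n) (Fin n) ℝ)
    (J : Matrix (Fin d) (Fin n) ℝ)
    (H : Fin d → Matrix (Fin n) (Fin n) ℝ)
    (R : Matrix (Fin d) (Fin d) ℝ)
    (D : Matrix (Fin d) (Fin d) ℝ)
    (Ξ : Matrix (Fin d) (Fin d) ℝ)
    (hΞ : ∀ i j, Ξ i j = (P * H i * P * H j).trace)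
    (S : Matrix (Fin d) (Fin d) ℝ)
    (hS : S = J * P * Jᵀ + (1 / 2 : ℝ) • Ξ + R)
    (Jhat : Matrix (Fin d) (Fin n) ℝ) (hJhat : Jhat = D * J)
    (Hhat : Fin d → Matrix (Fin n) (Fin n) ℝ)
    (hHhat : ∀ i, Hhat i = ∑ k, D i k • H k)
    (Rhat : Matrix (Fin d) (Fin d) ℝ) (hRhat : Rhat = D * R * Dᵀ)
    (Ξhat : Matrix (Fin d) (Fin d) ℝ)
    (hΞhat : ∀ i j, Ξhat i j = (P * Hhat i * P * Hhat j).trace)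
    (Shat : Matrix (Fin d) (Fin d) ℝ)
    (hShat : Shat = Jhat * P * Jhatᵀ + (1 / 2 : ℝ) • Ξhat + Rhat) :
    Shat = D * S * Dᵀ := by
  obtain rfl : Ξ = Matrix.of fun k l => (P * H k * P * H l).trace := Matrix.ext hΞ
  obtain rfl : Ξhat = D * Matrix.of (fun k l => (P * H k * P * H l).trace) * Dᵀ := by
    ext i j
    rw [hΞhat, hHhat, hHhat, trace_mul_linearCombination_eq_congr]
  subst hS hJhat hRhat hShat
  simp only [Matrix.mul_add, Matrix.add_mul, Matrix.mul_smul, Matrix.smul_mul, transpose_mul,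
    Matrix.mul_assoc]
end

section
/- Let D ∈ ℝ^{d×d} be invertible and suppose S = J P Jᵀ + (1/2) Ξ + R is invertible, where Ξ_{i,j} = tr(P H_i P H_j). Then with Ĵ = D J, Ĥ_i = Σ_{k=1}^d D_{i,k} H_k, R̂ = D R Dᵀ, Ξ̂_{i,j} = tr(P Ĥ_i P Ĥ_j), Ŝ = Ĵ P Ĵᵀ + (1/2) Ξ̂ + R̂ and K̂ = P Ĵᵀ Ŝ⁻¹, the transformed Kalman gain satisfies K̂ = K D⁻¹, where K = P Jᵀ S⁻¹. -/
open Matrix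

/-- The matrix `tr (P * H i * P * H j)` is conjugated as `D * Ξ * Dᵀ` when the family `H` is
replaced by its linear combinations with coefficients the rows of `D`. -/
theorem trace_gram_sum_smul {ι κ m 𝕜 : Type*} [Fintype κ] [Fintype m] [CommRing 𝕜]
    (P : Matrix m m 𝕜) (H : κ → Matrix m m 𝕜) (D : Matrix ι κ 𝕜)
    {Ξ : Matrix κ κ 𝕜} (hΞ : ∀ i j, Ξ i j = (P * H i * P * H j).trace)
    {H' : ι → Matrix m m 𝕜} (hH' : ∀ i, H' i = ∑ k, D i k • H k)
    {Ξ' : Matrix ι ι 𝕜} (hΞ' : ∀ i j, Ξ' i j = (P * H' i * P * H' j).trace) :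
    Ξ' = D * Ξ * Dᵀ := by
  ext i j
  simp only [hΞ', hH', Matrix.mul_sum, trace_sum, Matrix.mul_smul,
    Matrix.smul_mul, trace_smul, smul_eq_mul, mul_apply, transpose_apply, hΞ, Finset.sum_mul]
  rw [Finset.sum_comm]
  refine Finset.sum_congr rfl fun l _ => Finset.sum_congr rfl fun k _ => ?_
  ring

/-- The EKF2 Kalman gain transforms as `K̂ = K D⁻¹` under an invertible linear transformation
of the measurement model, provided the innovation covariance `S` is invertible. -/
theorem ekf2_gain_transform {n d : ℕ}
    (P : Matrix (Fin n) (Fin n) ℝ)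
    (J : Matrix (Fin d) (Fin n) ℝ)
    (H : Fin d → Matrix (Fin n) (Fin n) ℝ)
    (R : Matrix (Fin d) (Fin d) ℝ)
    (D : Matrix (Fin d) (Fin d) ℝ) (hD : IsUnit D.det)
    (Ξ : Matrix (Fin d) (Fin d) ℝ)
    (hΞ : ∀ i j, Ξ i j = (P * H i * P * H j).trace)
    (S : Matrix (Fin d) (Fin d) ℝ)
    (hS : S = J * P * Jᵀ + (1 / 2 : ℝ) • Ξ + R) (hSinv : IsUnit S.det)
    (K : Matrix (Fin n) (Fin d) ℝ) (hK : K = P * Jᵀ * S⁻¹)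
    (Jhat : Matrix (Fin d) (Fin n) ℝ) (hJhat : Jhat = D * J)
    (Hhat : Fin d → Matrix (Fin n) (Fin n) ℝ)
    (hHhat : ∀ i, Hhat i = ∑ k, D i k • H k)
    (Rhat : Matrix (Fin d) (Fin d) ℝ) (hRhat : Rhat = D * R * Dᵀ)
    (Ξhat : Matrix (Fin d) (Fin d) ℝ)
    (hΞhat : ∀ i j, Ξhat i j = (P * Hhat i * P * Hhat j).trace)
    (Shat : Matrix (Fin d) (Fin d) ℝ)
    (hShat : Shat = Jhat * P * Jhatᵀ + (1 / 2 : ℝ) • Ξhat + Rhat)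
    (Khat : Matrix (Fin n) (Fin d) ℝ) (hKhat : Khat = P * Jhatᵀ * Shat⁻¹) :
    Khat = K * D⁻¹ := by
  have hΞ_conj : Ξhat = D * Ξ * Dᵀ := trace_gram_sum_smul P H D hΞ hHhat hΞhat
  have hS_conj : Shat = D * S * Dᵀ := by
    rw [hShat, hS, hRhat, hJhat, hΞ_conj]
    simp only [transpose_mul, Matrix.mul_add, Matrix.add_mul, Matrix.mul_smul, Matrix.smul_mul,
      Matrix.mul_assoc]
  have hDt : IsUnit Dᵀ.det := by rwa [det_transpose]
  rw [hKhat, hK, hJhat, hS_conj, transpose_mul, Matrix.mul_inv_rev, Matrix.mul_inv_rev]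
  simp only [Matrix.mul_assoc]
  rw [mul_nonsing_inv_cancel_left _ _ hDt]
end

section
/- The EKF update is invariant under an invertible linear transformation of the measurement model: let D ∈ ℝ^{d×d} be invertible and suppose S = J P Jᵀ + R is invertible. Define the transformed model by Ĵ = D J, R̂ = D R Dᵀ, ŷ = D y, ẑ = D z, and let Ŝ = Ĵ P Ĵᵀ + R̂, K̂ = P Ĵᵀ Ŝ⁻¹, μ̂⁺ = μ + K̂ (ŷ − ẑ), P̂⁺ = P − K̂ Ŝ K̂ᵀ. Then μ̂⁺ = μ⁺ and P̂⁺ = P⁺. -/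
open Matrix

/-- The EKF update is invariant under an invertible linear transformation of the measurement
model: the transformed posterior mean and covariance equal the untransformed ones. -/
theorem ekf_update_invariant_under_linear_transform {n d : ℕ}
    (μ : Fin n → ℝ)
    (P : Matrix (Fin n) (Fin n) ℝ)
    (J : Matrix (Fin d) (Fin n) ℝ)
    (R : Matrix (Fin d) (Fin d) ℝ)
    (z y : Fin d → ℝ)
    (D : Matrix (Fin d) (Fin d) ℝ) (hD : IsUnit D.det)
    -- EKF update quantities for the original measurement model
    (S : Matrix (Fin d) (Fin d) ℝ) (hS : S = J * P * Jᵀ + R) (hSinv : IsUnit S.det)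
    (K : Matrix (Fin n) (Fin d) ℝ) (hK : K = P * Jᵀ * S⁻¹)
    (μplus : Fin n → ℝ) (hμplus : μplus = μ + K.mulVec (y - z))
    (Pplus : Matrix (Fin n) (Fin n) ℝ) (hPplus : Pplus = P - K * S * Kᵀ)
    -- the transformed measurement model
    (Jhat : Matrix (Fin d) (Fin n) ℝ) (hJhat : Jhat = D * J)
    (Rhat : Matrix (Fin d) (Fin d) ℝ) (hRhat : Rhat = D * R * Dᵀ)
    (yhat : Fin d → ℝ) (hyhat : yhat = D.mulVec y)
    (zhat : Fin d → ℝ) (hzhat : zhat = D.mulVec z)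
    -- EKF update quantities for the transformed measurement model
    (Shat : Matrix (Fin d) (Fin d) ℝ) (hShat : Shat = Jhat * P * Jhatᵀ + Rhat)
    (Khat : Matrix (Fin n) (Fin d) ℝ) (hKhat : Khat = P * Jhatᵀ * Shat⁻¹)
    (μhatplus : Fin n → ℝ) (hμhatplus : μhatplus = μ + Khat.mulVec (yhat - zhat))
    (Phatplus : Matrix (Fin n) (Fin n) ℝ) (hPhatplus : Phatplus = P - Khat * Shat * Khatᵀ) :
    μhatplus = μplus ∧ Phatplus = Pplus := by
  have hShat' : Shat = D * S * Dᵀ := by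
    rw [hShat, hJhat, hRhat, hS, transpose_mul]
    simp only [Matrix.mul_add, Matrix.add_mul, Matrix.mul_assoc]
  have hDt : IsUnit Dᵀ.det := by rwa [det_transpose]
  have hKD : Khat * D = K := by
    rw [hKhat, hShat', hJhat, hK, transpose_mul, Matrix.mul_inv_rev, Matrix.mul_inv_rev]
    simp only [Matrix.mul_assoc, nonsing_inv_mul D hD, Matrix.mul_one,
      mul_nonsing_inv_cancel_left _ _ hDt]
  constructor
  · rw [hμhatplus, hμplus, hyhat, hzhat, ← mulVec_sub, mulVec_mulVec, hKD]
  · rw [hPhatplus, hPplus, hShat', ← hKD, transpose_mul]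
    simp only [Matrix.mul_assoc]
end

section
/- Let R ∈ ℝ^{d×d} with R = L Lᵀ for an invertible L ∈ ℝ^{d×d}, and let Ξ ∈ ℝ^{d×d} be symmetric. Then for every matrix D ∈ ℝ^{d×d} with D R Dᵀ = I and every index i, the diagonal entry (D Ξ Dᵀ)_{i,i} is at least the smallest eigenvalue of the symmetric matrix L⁻¹ Ξ L⁻ᵀ. In particular, no transformation that normalizes the measurement noise covariance to the identity can produce a diagonal nonlinearity entry below the smallest eigenvalue of L⁻¹ Ξ L⁻ᵀ. -/
open Matrix

/-- The diagonal entries of `W * diagonal v * Wᵀ`, for `W` with orthonormal rows, are bounded below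
by the infimum of `v`. -/
theorem iInf_le_mul_diagonal_mul_transpose_apply {m n : Type*} [DecidableEq m] [Fintype n]
    [DecidableEq n] (W : Matrix m n ℝ) (hW : W * Wᵀ = 1) (v : n → ℝ) (i : m) :
    (⨅ j, v j) ≤ (W * diagonal v * Wᵀ) i i := by
  have hrow : ∑ j, W i j * W i j = 1 := by
    simpa [Matrix.mul_apply] using congrFun (congrFun hW i) i
  calc (⨅ j, v j) = ∑ j, (⨅ k, v k) * (W i j * W i j) := by
        rw [← Finset.mul_sum, hrow, mul_one]
    _ ≤ ∑ j, v j * (W i j * W i j) := by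
        gcongr with j
        · exact mul_self_nonneg _
        · exact ciInf_le (Set.finite_range v).bddBelow j
    _ = (W * diagonal v * Wᵀ) i i := by
        rw [Matrix.mul_apply]
        simp only [mul_diagonal, transpose_apply]
        exact Finset.sum_congr rfl fun j _ => by ring

/-- Conjugating a symmetric real matrix by a matrix with orthonormal rows gives diagonal entries
bounded below by the smallest eigenvalue. -/
theorem Matrix.IsHermitian.iInf_eigenvalues_le_mul_mul_transpose_apply {m n : Type*}
    [DecidableEq m] [Fintype n] [DecidableEq n] {A : Matrix n n ℝ} (hA : A.IsHermitian)
    (M : Matrix m n ℝ) (hM : M * Mᵀ = 1) (i : m) :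
    (⨅ j, hA.eigenvalues j) ≤ (M * A * Mᵀ) i i := by
  set U : Matrix n n ℝ := hA.eigenvectorUnitary.1 with hU
  have hUU : U * Uᵀ = 1 := by
    simpa [star_eq_conjTranspose] using Unitary.coe_mul_star_self hA.eigenvectorUnitary
  have hspec : A = U * diagonal hA.eigenvalues * Uᵀ := by
    conv_lhs => rw [hA.spectral_theorem, Unitary.conjStarAlgAut_apply]
    simp [hU, star_eq_conjTranspose]
  have hW : (M * U) * (M * U)ᵀ = 1 := by
    rw [transpose_mul, Matrix.mul_assoc, ← Matrix.mul_assoc U, hUU, Matrix.one_mul, hM]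
  have hconj : M * A * Mᵀ = (M * U) * diagonal hA.eigenvalues * (M * U)ᵀ := by
    conv_lhs => rw [hspec]
    simp only [transpose_mul, Matrix.mul_assoc]
  rw [hconj]
  exact iInf_le_mul_diagonal_mul_transpose_apply _ hW _ i

/-- For any transformation `D` that normalizes the measurement noise covariance `R = L Lᵀ`
to the identity (`D R Dᵀ = I`), every diagonal entry of the transformed nonlinearity matrix
`D Ξ Dᵀ` is at least the smallest eigenvalue of the symmetric matrix `L⁻¹ Ξ L⁻ᵀ`. -/
theorem diag_nonlinearity_ge_smallest_eigenvalue {d : ℕ} (hd : 0 < d)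
    (L R Ξ : Matrix (Fin d) (Fin d) ℝ)
    (hL : IsUnit L.det)
    (hR : R = L * Lᵀ)
    (hΞ : Ξᵀ = Ξ)
    (hA : (L⁻¹ * Ξ * (L⁻¹)ᵀ).IsHermitian) :
    ∀ D : Matrix (Fin d) (Fin d) ℝ, D * R * Dᵀ = 1 →
      ∀ i, (⨅ j, hA.eigenvalues j) ≤ (D * Ξ * Dᵀ) i i := by
  intro D hD i
  have hM : (D * L) * (D * L)ᵀ = 1 := by
    rw [← hD, hR, transpose_mul]
    simp only [Matrix.mul_assoc]
  have hconj : D * Ξ * Dᵀ = (D * L) * (L⁻¹ * Ξ * (L⁻¹)ᵀ) * (D * L)ᵀ := by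
    have hLt : (L⁻¹)ᵀ * Lᵀ = 1 := by
      rw [← transpose_mul, mul_nonsing_inv L hL, transpose_one]
    calc D * Ξ * Dᵀ = D * (L * L⁻¹) * Ξ * ((L⁻¹)ᵀ * Lᵀ) * Dᵀ := by
          rw [mul_nonsing_inv L hL, hLt, Matrix.mul_one, Matrix.mul_one]
      _ = _ := by simp only [transpose_mul, Matrix.mul_assoc]
  rw [hconj]
  exact hA.iInf_eigenvalues_le_mul_mul_transpose_apply (D * L) hM i
end
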